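/- Let z₀ = H a* be the common measurement of the LASSO solution set α_λ (for any a* ∈ α_λ). Then every extreme point of the solution set of the linear program min { ‖a‖₁ : a ∈ ℝ^N, H a = z₀ } is an extreme point of α_λ, and every such extreme point a satisfies ‖a‖₀ ≤ M. -/

import Mathlib

theorem abs_add_add_abs_sub_of_abs_le {a t : ℝ} (h : |t| ≤ |a|) :
    |a + t| + |a - t| = 2 * |a| := by
  grind

/-- A matrix with `M` rows has a nonzero kernel vector supported in any set of more than
`M` columns. -/
theorem exists_ne_zero_mulVec_eq_zero_of_card_lt {M N : ℕ} (H : Matrix (Fin M) (Fin N) ℝ)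
    (s : Finset (Fin N)) (hs : M < s.card) :
    ∃ v : Fin N → ℝ, v ≠ 0 ∧ H.mulVec v = 0 ∧ ∀ n ∉ s, v n = 0 := by
  let f : (Fin N → ℝ) →ₗ[ℝ] (Fin M → ℝ) × ({n // n ∈ sᶜ} → ℝ) :=
    H.mulVecLin.prod (LinearMap.funLeft ℝ ℝ Subtype.val)
  have hf : f.ker ≠ ⊥ := by
    apply LinearMap.ker_ne_bot_of_finrank_lt
    have h := s.card_le_univ
    simp only [Module.finrank_prod, Module.finrank_fintype_fun_eq_card, Fintype.card_fin,
      Fintype.card_coe, Finset.card_compl] at h ⊢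
    omega
  obtain ⟨v, hv, hv0⟩ := Submodule.exists_mem_ne_zero_of_ne_bot hf
  obtain ⟨h1, h2⟩ := Prod.ext_iff.mp (LinearMap.mem_ker.mp hv)
  exact ⟨v, hv0, h1, fun n hn => congrFun h2 ⟨n, by simpa using hn⟩⟩

theorem exists_pos_abs_smul_le {ι : Type*} [Finite ι] (a v : ι → ℝ)
    (h : ∀ n, a n = 0 → v n = 0) : ∃ ε : ℝ, 0 < ε ∧ ∀ n, |ε * v n| ≤ |a n| := by
  have hev : ∀ᶠ ε : ℝ in nhdsWithin 0 (Set.Ioi 0), ∀ n, |ε * v n| ≤ |a n| := by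
    rw [Filter.eventually_all]
    intro n
    by_cases ha : a n = 0
    · simp [h n ha]
    · have hc : Filter.Tendsto (fun ε : ℝ => |ε * v n|) (nhds 0) (nhds 0) := by
        have : Continuous fun ε : ℝ => |ε * v n| := by fun_prop
        simpa using this.tendsto 0
      exact ((hc.mono_left nhdsWithin_le_nhds).eventually_lt_const (abs_pos.mpr ha)).mono
        fun _ => le_of_lt
  obtain ⟨ε, h1, h2⟩ := (hev.and self_mem_nhdsWithin).exists
  exact ⟨ε, h2, h1⟩

/-- Extreme points of the set of `ℓ¹`-minimal solutions of `H a = y` have at most as many nonzero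
entries as `H` has rows. -/
theorem card_support_le_of_mem_extremePoints_basisPursuit {M N : ℕ}
    (H : Matrix (Fin M) (Fin N) ℝ) (y : Fin M → ℝ) {a : Fin N → ℝ}
    (ha : a ∈ Set.extremePoints ℝ {a : Fin N → ℝ | H.mulVec a = y ∧
      ∀ b : Fin N → ℝ, H.mulVec b = y → (∑ n : Fin N, |a n|) ≤ ∑ n : Fin N, |b n|}) :
    (Finset.univ.filter fun n : Fin N => a n ≠ 0).card ≤ M := by
  by_contra! hcard
  obtain ⟨v, hv0, hHv, hvs⟩ := exists_ne_zero_mulVec_eq_zero_of_card_lt H _ hcard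
  obtain ⟨ε, hε, hle⟩ := exists_pos_abs_smul_le a v fun n hn => hvs n (by simpa using hn)
  obtain ⟨⟨hHa, hmin⟩, hext⟩ := mem_extremePoints.mp ha
  have hsum : (∑ n, |(a + ε • v) n|) + ∑ n, |(a - ε • v) n| = 2 * ∑ n, |a n| := by
    rw [← Finset.sum_add_distrib, Finset.mul_sum]
    exact Finset.sum_congr rfl fun n _ => abs_add_add_abs_sub_of_abs_le (hle n)
  have hplus : H.mulVec (a + ε • v) = y := by
    rw [Matrix.mulVec_add, Matrix.mulVec_smul, hHv, smul_zero, add_zero, hHa]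
  have hminus : H.mulVec (a - ε • v) = y := by
    rw [Matrix.mulVec_sub, Matrix.mulVec_smul, hHv, smul_zero, sub_zero, hHa]
  have hp := hmin _ hplus
  have hm := hmin _ hminus
  have heq := (hext (a + ε • v) ⟨hplus, fun b hb => by linarith [hmin b hb]⟩
    (a - ε • v) ⟨hminus, fun b hb => by linarith [hmin b hb]⟩
    ⟨1 / 2, 1 / 2, by norm_num, by norm_num, by norm_num, by module⟩).1
  exact hv0 ((smul_eq_zero.mp (add_eq_left.mp heq)).resolve_left hε.ne')


/-- Every extreme point of the solution set of the linear program
`min { ‖a‖₁ : H a = z₀ }`, where `z₀` is the common measurement of the LASSO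
solution set `α_λ`, is an extreme point of `α_λ`, and any such extreme point `a`
satisfies `‖a‖₀ ≤ M`. -/
theorem extreme_points_of_lp_are_extreme_points_of_lasso
    {M N : ℕ} (hMN : M < N) (H : Matrix (Fin M) (Fin N) ℝ) (z : Fin M → ℝ)
    (lam : ℝ) (hlam : 0 < lam)
    (F : (Fin N → ℝ) → ℝ)
    (hF : ∀ a : Fin N → ℝ,
      F a = (∑ i : Fin M, (z i - H.mulVec a i) ^ 2) + lam * ∑ n : Fin N, |a n|)
    (α : Set (Fin N → ℝ))
    (hα : α = {a : Fin N → ℝ | ∀ b : Fin N → ℝ, F a ≤ F b})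
    (astar : Fin N → ℝ) (hastar : astar ∈ α)
    (z₀ : Fin M → ℝ) (hz₀ : z₀ = H.mulVec astar)
    (hsame : ∀ a ∈ α, H.mulVec a = z₀)
    (β : Set (Fin N → ℝ))
    (hβ : β = {a : Fin N → ℝ | H.mulVec a = z₀ ∧
      ∀ b : Fin N → ℝ, H.mulVec b = z₀ → (∑ n : Fin N, |a n|) ≤ ∑ n : Fin N, |b n|}) :
    ∀ a ∈ Set.extremePoints ℝ β,
      a ∈ Set.extremePoints ℝ α ∧
        (Finset.univ.filter fun n : Fin N => a n ≠ 0).card ≤ M := by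
  have hαβ : α = β := by
    subst hα hβ
    ext a
    constructor
    · intro ha
      refine ⟨hsame a ha, fun b hb => ?_⟩
      have h := ha b
      rw [hF, hF, hsame a ha, hb] at h
      exact le_of_mul_le_mul_left (by linarith) hlam
    · rintro ⟨hHa, hmin⟩ b
      refine le_trans ?_ (hastar b)
      rw [hF, hF, hHa, ← hz₀]
      gcongr _ + lam * ?_
      exact hmin astar hz₀.symm
  intro a ha
  refine ⟨hαβ ▸ ha, ?_⟩
  rw [hβ] at ha
  exact card_support_le_of_mem_extremePoints_basisPursuit H z₀ ha
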